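/- Let A(x) denote the 2×2 rotation matrix ((cos x, −sin x),(sin x, cos x)). Let R₃(x,y) be the 9×9 block-diagonal matrix diag(A(x), A(y), A(x+y), A(x−y), 1) and let v₃ : ℝ → ℝ⁹ be v₃(z) = (2, 1+sin z, cos z, 1/2+sin z, cos z, sin z, cos z, 2−cos z, −2 sin z − 5 cos z). Define F₃ : ℝ³ → ℝ⁹ by F₃(x,y,z) = R₃(x,y)·v₃(z). Then F₃ is free: at every point (x,y,z) ∈ ℝ³ the nine vectors ∂ₓF₃, ∂ᵧF₃, ∂_zF₃, ∂ₓₓF₃, ∂ₓᵧF₃, ∂ₓ_zF₃, ∂ᵧᵧF₃, ∂ᵧ_zF₃, ∂_{zz}F₃ ∈ ℝ⁹ are linearly independent. Since F₃ is 2π-periodic in each variable, it induces a smooth free map of the 3-torus T³ into ℝ⁹, which is the critical dimension q₃ = 3·(3+3)/2 = 9. -/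

import Mathlib

open Real Matrix

/-- The 9×9 block-diagonal rotation matrix `R₃(x,y) = diag(A(x), A(y), A(x+y), A(x−y), 1)`,
where `A(t)` is the 2×2 rotation matrix `((cos t, −sin t),(sin t, cos t))`. -/
noncomputable def R₃ (x y : ℝ) : Matrix (Fin 9) (Fin 9) ℝ :=
  !![cos (x), -sin (x), 0, 0, 0, 0, 0, 0, 0;
    sin (x), cos (x), 0, 0, 0, 0, 0, 0, 0;
    0, 0, cos (y), -sin (y), 0, 0, 0, 0, 0;
    0, 0, sin (y), cos (y), 0, 0, 0, 0, 0;
    0, 0, 0, 0, cos (x + y), -sin (x + y), 0, 0, 0;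
    0, 0, 0, 0, sin (x + y), cos (x + y), 0, 0, 0;
    0, 0, 0, 0, 0, 0, cos (x - y), -sin (x - y), 0;
    0, 0, 0, 0, 0, 0, sin (x - y), cos (x - y), 0;
    0, 0, 0, 0, 0, 0, 0, 0, 1]

/-- The loop `v₃ : ℝ → ℝ⁹`. -/
noncomputable def v₃ (z : ℝ) : Fin 9 → ℝ :=
  ![2, 1 + sin z, cos z, 1 / 2 + sin z, cos z, sin z, cos z, 2 - cos z,
    -2 * sin z - 5 * cos z]

/-- The map `F₃(x,y,z) = R₃(x,y)·v₃(z) : ℝ³ → ℝ⁹`. -/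
noncomputable def F₃ (x y z : ℝ) : Fin 9 → ℝ := R₃ x y *ᵥ v₃ z

/-- Lower bound for the determinant governing freeness of `F₃`: up to an error of small
coefficients it is a sum of two squares of trigonometric polynomials. -/
lemma freeness_det_pos {s c : ℝ} (h : s ^ 2 + c ^ 2 = 1) :
    0 < 481 / 2 - 218 * c + 123 * s - 65 * s * c - 224 * s ^ 2 + 273 / 2 * s ^ 2 * c
      - 128 * s ^ 3 + 51 / 2 * s ^ 3 * c - 17 / 2 * s ^ 4 + 13 * s ^ 4 * c + 11 * s ^ 5 := by
  have hs : |s| ≤ 1 := abs_le_one_iff_mul_self_le_one.2 (by nlinarith)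
  have hc : |c| ≤ 1 := abs_le_one_iff_mul_self_le_one.2 (by nlinarith)
  have hb (i j : ℕ) : -1 ≤ s ^ i * c ^ j ∧ s ^ i * c ^ j ≤ 1 := by
    rw [← abs_le, abs_mul, abs_pow, abs_pow]
    exact mul_le_one₀ (pow_le_one₀ (abs_nonneg s) hs) (by positivity)
      (pow_le_one₀ (abs_nonneg c) hc)
  set X := -1083 / 125 + 11883 / 1000 * c + 597 / 1000 * s - 5179 / 1000 * s * c
    + 11097 / 1000 * s ^ 2 - 3002 / 125 * s ^ 2 * c + 157 / 250 * s ^ 3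
  set Y := 4741 / 1000 - 319 / 250 * c + 23987 / 1000 * s - 11361 / 1000 * s * c
    - 1083 / 200 * s ^ 2 - 157 / 250 * s ^ 2 * c - 3002 / 125 * s ^ 3
  have hXY : 481 / 2 - 218 * c + 123 * s - 65 * s * c - 224 * s ^ 2 + 273 / 2 * s ^ 2 * c
      - 128 * s ^ 3 + 51 / 2 * s ^ 3 * c - 17 / 2 * s ^ 4 + 13 * s ^ 4 * c + 11 * s ^ 5
      = X ^ 2 + Y ^ 2 + (62079 / 500000 + 957 / 125000 * c - 2269 / 250000 * s
        + 2453 / 250000 * s * c + 2371 / 1000000 * s ^ 2 - 14297 / 500000 * s ^ 2 * c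
        + 6551 / 500000 * s ^ 3 - 1001 / 125000 * s ^ 3 * c - 11 / 6250 * s ^ 4
        + 723 / 31250 * s ^ 4 * c - 62 / 15625 * s ^ 5) := by
    grind
  have h01 := hb 0 1
  have h10 := hb 1 0
  have h11 := hb 1 1
  have h20 := hb 2 0
  have h21 := hb 2 1
  have h30 := hb 3 0
  have h31 := hb 3 1
  have h40 := hb 4 0
  have h41 := hb 4 1
  have h50 := hb 5 0
  simp only [pow_zero, pow_one, mul_one, one_mul] at h01 h10 h11 h20 h21 h30 h31 h40 h41 h50
  rw [hXY]
  linarith [sq_nonneg X, sq_nonneg Y]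

/-- Infinitesimal generator of the rotations `R₃ x y`, with angular speeds `k i`. -/
def rotGen (k : Fin 4 → ℝ) (v : Fin 9 → ℝ) : Fin 9 → ℝ :=
  ![-(k 0 * v 1), k 0 * v 0, -(k 1 * v 3), k 1 * v 2, -(k 2 * v 5), k 2 * v 4,
    -(k 3 * v 7), k 3 * v 6, 0]

lemma R₃_mulVec (x y : ℝ) (v : Fin 9 → ℝ) :
    R₃ x y *ᵥ v = ![cos x * v 0 - sin x * v 1, sin x * v 0 + cos x * v 1,
      cos y * v 2 - sin y * v 3, sin y * v 2 + cos y * v 3,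
      cos (x + y) * v 4 - sin (x + y) * v 5, sin (x + y) * v 4 + cos (x + y) * v 5,
      cos (x - y) * v 6 - sin (x - y) * v 7, sin (x - y) * v 6 + cos (x - y) * v 7, v 8] := by
  ext i
  fin_cases i <;> simp [R₃, mulVec, dotProduct, Fin.sum_univ_succ] <;> ring

lemma R₃_mulVec_injective (x y : ℝ) : Function.Injective fun v => R₃ x y *ᵥ v := by
  refine Function.LeftInverse.injective (g := fun v => R₃ (-x) (-y) *ᵥ v) fun v => ?_
  have hx := sin_sq_add_cos_sq x
  have hy := sin_sq_add_cos_sq y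
  have hp := sin_sq_add_cos_sq (x + y)
  have hm := sin_sq_add_cos_sq (x - y)
  have e₁ : -x + -y = -(x + y) := by ring
  have e₂ : -x - -y = -(x - y) := by ring
  simp only [R₃_mulVec, e₁, e₂, cos_neg, sin_neg]
  ext i
  fin_cases i <;> simp <;> grind

lemma hasDerivAt_cos_mul_sub_sin_mul {φ : ℝ → ℝ} {k x : ℝ} (h : HasDerivAt φ k x) (a b : ℝ) :
    HasDerivAt (fun t => cos (φ t) * a - sin (φ t) * b)
      (cos (φ x) * -(k * b) - sin (φ x) * (k * a)) x :=
  ((h.cos.mul_const a).sub (h.sin.mul_const b)).congr_deriv (by ring)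

lemma hasDerivAt_sin_mul_add_cos_mul {φ : ℝ → ℝ} {k x : ℝ} (h : HasDerivAt φ k x) (a b : ℝ) :
    HasDerivAt (fun t => sin (φ t) * a + cos (φ t) * b)
      (sin (φ x) * -(k * b) + cos (φ x) * (k * a)) x :=
  ((h.sin.mul_const a).add (h.cos.mul_const b)).congr_deriv (by ring)

lemma hasDerivAt_R₃_left (x y : ℝ) (v : Fin 9 → ℝ) :
    HasDerivAt (fun t => R₃ t y *ᵥ v) (R₃ x y *ᵥ rotGen ![1, 0, 1, 1] v) x := by
  have h₀ := hasDerivAt_id' x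
  have h₁ := hasDerivAt_const x y
  have h₂ := h₀.add_const y
  have h₃ := h₀.sub_const y
  simp only [R₃_mulVec]
  rw [hasDerivAt_pi]
  intro i
  fin_cases i
  exacts [hasDerivAt_cos_mul_sub_sin_mul h₀ _ _, hasDerivAt_sin_mul_add_cos_mul h₀ _ _,
    hasDerivAt_cos_mul_sub_sin_mul h₁ _ _, hasDerivAt_sin_mul_add_cos_mul h₁ _ _,
    hasDerivAt_cos_mul_sub_sin_mul h₂ _ _, hasDerivAt_sin_mul_add_cos_mul h₂ _ _,
    hasDerivAt_cos_mul_sub_sin_mul h₃ _ _, hasDerivAt_sin_mul_add_cos_mul h₃ _ _,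
    hasDerivAt_const _ _]

lemma hasDerivAt_R₃_right (x y : ℝ) (v : Fin 9 → ℝ) :
    HasDerivAt (fun t => R₃ x t *ᵥ v) (R₃ x y *ᵥ rotGen ![0, 1, 1, -1] v) y := by
  have h₀ := hasDerivAt_const y x
  have h₁ := hasDerivAt_id' y
  have h₂ := h₁.const_add x
  have h₃ := h₁.const_sub x
  simp only [R₃_mulVec]
  rw [hasDerivAt_pi]
  intro i
  fin_cases i
  exacts [hasDerivAt_cos_mul_sub_sin_mul h₀ _ _, hasDerivAt_sin_mul_add_cos_mul h₀ _ _,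
    hasDerivAt_cos_mul_sub_sin_mul h₁ _ _, hasDerivAt_sin_mul_add_cos_mul h₁ _ _,
    hasDerivAt_cos_mul_sub_sin_mul h₂ _ _, hasDerivAt_sin_mul_add_cos_mul h₂ _ _,
    hasDerivAt_cos_mul_sub_sin_mul h₃ _ _, hasDerivAt_sin_mul_add_cos_mul h₃ _ _,
    hasDerivAt_const _ _]

lemma hasDerivAt_R₃_mulVec (x y : ℝ) {w : ℝ → Fin 9 → ℝ} {w' : Fin 9 → ℝ} {z : ℝ}
    (h : HasDerivAt w w' z) : HasDerivAt (fun t => R₃ x y *ᵥ w t) (R₃ x y *ᵥ w') z :=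
  (Matrix.toLin' (R₃ x y)).toContinuousLinearMap.hasFDerivAt.comp_hasDerivAt z h

lemma hasDerivAt_rotGen (k : Fin 4 → ℝ) {w : ℝ → Fin 9 → ℝ} {w' : Fin 9 → ℝ} {z : ℝ}
    (h : HasDerivAt w w' z) : HasDerivAt (fun t => rotGen k (w t)) (rotGen k w') z := by
  rw [hasDerivAt_pi] at h ⊢
  intro i
  fin_cases i
  exacts [((h 1).const_mul _).neg, (h 0).const_mul _, ((h 3).const_mul _).neg, (h 2).const_mul _,
    ((h 5).const_mul _).neg, (h 4).const_mul _, ((h 7).const_mul _).neg, (h 6).const_mul _,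
    hasDerivAt_const _ _]

/-- The derivative of `v₃`. -/
noncomputable def derivV₃ (z : ℝ) : Fin 9 → ℝ :=
  ![0, cos z, -sin z, cos z, -sin z, cos z, -sin z, sin z, -2 * cos z + 5 * sin z]

/-- The second derivative of `v₃`. -/
noncomputable def derivDerivV₃ (z : ℝ) : Fin 9 → ℝ :=
  ![0, -sin z, -cos z, -sin z, -cos z, -sin z, -cos z, cos z, 2 * sin z + 5 * cos z]

lemma hasDerivAt_v₃ (z : ℝ) : HasDerivAt v₃ (derivV₃ z) z := by
  have hs := hasDerivAt_sin z
  have hc := hasDerivAt_cos z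
  rw [hasDerivAt_pi]
  intro i
  fin_cases i
  exacts [hasDerivAt_const _ _, hs.const_add _, hc, hs.const_add _, hc, hs, hc,
    (hc.const_sub 2).congr_deriv (neg_neg _),
    ((hs.const_mul (-2)).sub (hc.const_mul 5)).congr_deriv
      (show _ = -2 * cos z + 5 * sin z by ring)]

lemma hasDerivAt_derivV₃ (z : ℝ) : HasDerivAt derivV₃ (derivDerivV₃ z) z := by
  have hs := hasDerivAt_sin z
  have hc := hasDerivAt_cos z
  rw [hasDerivAt_pi]
  intro i
  fin_cases i
  exacts [hasDerivAt_const _ _, hc, hs.neg, hc, hs.neg, hc, hs.neg, hs,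
    ((hc.const_mul (-2)).add (hs.const_mul 5)).congr_deriv
      (show _ = 2 * sin z + 5 * cos z by ring)]

/-- The `5 × 5` matrix left over from the linear system for the vanishing of a combination of
first and second derivatives of `F₃`, after elimination of four unknowns. Here `s` and `c` stand
for `sin z` and `cos z`. -/
noncomputable def reducedMatrix (s c : ℝ) : Matrix (Fin 5) (Fin 5) ℝ :=
  !![4 + (1 + s) ^ 2, c * (1 + s), 0, 0, 10;
    1 / 2 + s, 0, -c, -c, (2 * s + 5 * c) * (1 / 2 + s) - 2;
    -c, 0, -(1 / 2 + s), -s, 5 - (2 * s + 5 * c) * c;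
    -2 * (2 - c) + c * (1 + s), -c * (1 - c) - s, -2 * c, -c + s,
      -(2 * s + 5 * c) * (2 - c) - c * (2 * c - 5 * s) - 2;
    2 * c + (2 - c) * (1 + s), -(2 - c) * (1 - c) - s, -2 * (2 - c), -(2 - c) + s,
      (2 * s + 5 * c) * c - (2 - c) * (2 * c - 5 * s) + 2]

lemma det_reducedMatrix {s c : ℝ} (h : s ^ 2 + c ^ 2 = 1) :
    (reducedMatrix s c).det = 481 / 2 - 218 * c + 123 * s - 65 * s * c - 224 * s ^ 2
      + 273 / 2 * s ^ 2 * c - 128 * s ^ 3 + 51 / 2 * s ^ 3 * c - 17 / 2 * s ^ 4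
      + 13 * s ^ 4 * c + 11 * s ^ 5 := by
  simp [reducedMatrix, det_succ_row_zero, Fin.sum_univ_succ, Fin.succAbove]
  grind

/-- The partial derivatives of `F₃` of orders one and two, pulled back by `R₃ x y`, are linearly
independent. -/
lemma linearIndependent_frame (z : ℝ) : LinearIndependent ℝ
    ![rotGen ![1, 0, 1, 1] (v₃ z), rotGen ![0, 1, 1, -1] (v₃ z), derivV₃ z,
      rotGen ![1, 0, 1, 1] (rotGen ![1, 0, 1, 1] (v₃ z)),
      rotGen ![0, 1, 1, -1] (rotGen ![1, 0, 1, 1] (v₃ z)),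
      rotGen ![0, 1, 1, -1] (rotGen ![0, 1, 1, -1] (v₃ z)),
      rotGen ![1, 0, 1, 1] (derivV₃ z), rotGen ![0, 1, 1, -1] (derivV₃ z), derivDerivV₃ z] := by
  have h : sin z ^ 2 + cos z ^ 2 = 1 := sin_sq_add_cos_sq z
  have hdet := freeness_det_pos h
  rw [Fintype.linearIndependent_iff]
  intro g hg
  have e (i : Fin 9) := congrFun hg i
  simp only [rotGen, v₃, derivV₃, derivDerivV₃] at e
  generalize sin z = s at *
  generalize cos z = c at *
  have e0 := e 0
  have e1 := e 1
  have e2 := e 2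
  have e3 := e 3
  have e4 := e 4
  have e5 := e 5
  have e6 := e 6
  have e7 := e 7
  have e8 := e 8
  clear e hg
  simp [Fin.sum_univ_succ] at e0 e1 e2 e3 e4 e5 e6 e7 e8
  obtain ⟨l, hr, hzz⟩ : ∃ l, g 2 = l * (2 * s + 5 * c) ∧ g 8 = l * (2 * c - 5 * s) := by
    refine ⟨(g 2 * (2 * s + 5 * c) + g 8 * (2 * c - 5 * s)) / 29, ?_, ?_⟩
    · linear_combination -g 2 * h - (2 * c - 5 * s) / 29 * e8
    · linear_combination -g 8 * h + (2 * s + 5 * c) / 29 * e8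
  have hq : g 1 = -g 0 - g 2 := by
    linear_combination c * e5 - s * e4 - (g 0 + g 1 + g 2) * h
  have hxy : g 4 = -(g 3 + g 5 + g 6 + g 7 + g 8) := by
    linear_combination -c * e4 - s * e5 - (g 3 + g 4 + g 5 + g 6 + g 7 + g 8) * h
  have hxx : g 3 = (-(1 + s) * g 0 - c * g 6) / 2 := by linarith
  have hker : reducedMatrix s c *ᵥ ![g 0, g 6, g 5, g 7, l] = 0 := by
    simp only [hxy, hxx, hq, hr, hzz] at e1 e2 e3 e6 e7
    ext i
    fin_cases i <;> simp [reducedMatrix, mulVec, dotProduct, Fin.sum_univ_succ]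
    · linear_combination 2 * e1 - 10 * l * h
    · linear_combination e2 + 2 * l * h
    · linear_combination e3 - 5 * l * h
    · linear_combination e6 + 2 * l * h
    · linear_combination e7 - 2 * l * h
  have h0 := Matrix.eq_zero_of_mulVec_eq_zero (det_reducedMatrix h ▸ hdet.ne') hker
  have k0 : g 0 = 0 := congrFun h0 0
  have k6 : g 6 = 0 := congrFun h0 1
  have k5 : g 5 = 0 := congrFun h0 2
  have k7 : g 7 = 0 := congrFun h0 3
  have kl : l = 0 := congrFun h0 4
  intro i
  fin_cases i <;> simp [*]

/-- `F₃` is free: at every point the nine vectors of first and second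
partial derivatives are linearly independent in `ℝ⁹` (the critical dimension
`q₃ = 3·(3+3)/2 = 9`). Moreover `F₃` is smooth and `2π`-periodic in each variable,
hence induces a smooth free map of the 3-torus `T³` into `ℝ⁹`. -/
theorem F₃_free :
    (∀ x y z : ℝ, LinearIndependent ℝ
      ![deriv (fun t => F₃ t y z) x,
      deriv (fun t => F₃ x t z) y,
      deriv (fun t => F₃ x y t) z,
      deriv (fun t => deriv (fun s => F₃ s y z) t) x,
      deriv (fun t => deriv (fun s => F₃ s t z) x) y,
      deriv (fun t => deriv (fun s => F₃ x s z) t) y,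
      deriv (fun t => deriv (fun s => F₃ s y t) x) z,
      deriv (fun t => deriv (fun s => F₃ x s t) y) z,
      deriv (fun t => deriv (fun s => F₃ x y s) t) z])
    ∧ ContDiff ℝ (⊤ : ℕ∞) (fun p : ℝ × ℝ × ℝ => F₃ p.1 p.2.1 p.2.2)
    ∧ (∀ x y z : ℝ, F₃ (x + 2 * π) y z = F₃ x y z ∧ F₃ x (y + 2 * π) z = F₃ x y z ∧
        F₃ x y (z + 2 * π) = F₃ x y z) := by
  refine ⟨fun x y z => ?_, ?_, fun x y z => ⟨?_, ?_, ?_⟩⟩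
  · have hx (x y z : ℝ) : deriv (fun t => F₃ t y z) x = R₃ x y *ᵥ rotGen ![1, 0, 1, 1] (v₃ z) :=
      (hasDerivAt_R₃_left x y _).deriv
    have hy (x y z : ℝ) : deriv (fun t => F₃ x t z) y = R₃ x y *ᵥ rotGen ![0, 1, 1, -1] (v₃ z) :=
      (hasDerivAt_R₃_right x y _).deriv
    have hz (x y z : ℝ) : deriv (fun t => F₃ x y t) z = R₃ x y *ᵥ derivV₃ z :=
      (hasDerivAt_R₃_mulVec x y (hasDerivAt_v₃ z)).deriv
    simp only [hx, hy, hz, (hasDerivAt_R₃_left _ _ _).deriv, (hasDerivAt_R₃_right _ _ _).deriv,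
      (hasDerivAt_R₃_mulVec x y (hasDerivAt_rotGen _ (hasDerivAt_v₃ z))).deriv,
      (hasDerivAt_R₃_mulVec x y (hasDerivAt_derivV₃ z)).deriv]
    have hli := (linearIndependent_frame z).map' (Matrix.toLin' (R₃ x y))
      (LinearMap.ker_eq_bot.2 (R₃_mulVec_injective x y))
    refine Eq.subst (motive := fun u => LinearIndependent ℝ u) (funext fun i => ?_) hli
    fin_cases i <;> rfl
  · simp only [F₃, R₃_mulVec, v₃]
    rw [contDiff_pi]
    intro i
    fin_cases i <;> simp <;> fun_prop
  · have e₁ : x + 2 * π + y = x + y + 2 * π := by ring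
    have e₂ : x + 2 * π - y = x - y + 2 * π := by ring
    simp only [F₃, R₃_mulVec, e₁, e₂, sin_add_two_pi, cos_add_two_pi]
  · have e₁ : x + (y + 2 * π) = x + y + 2 * π := by ring
    have e₂ : x - (y + 2 * π) = x - y - 2 * π := by ring
    simp only [F₃, R₃_mulVec, e₁, e₂, sin_add_two_pi, cos_add_two_pi, sin_sub_two_pi,
      cos_sub_two_pi]
  · simp only [F₃, v₃, sin_add_two_pi, cos_add_two_pi]
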